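/- Let n ≥ 4 and let M be a matching of the complete graph K_n (a set of pairwise non-adjacent edges) with |M| ≥ 2. Then the graph K_n \ M obtained from K_n by deleting the edges of M satisfies κ_3(K_n \ M) = n − 3. -/

import Mathlib

open SimpleGraph

/-- Trees `T 0, …, T (r-1)` are internally disjoint `S`-trees in `G`: each `T i` is a
subgraph of `G` that is a tree containing every vertex of `S`, the edge sets are pairwise
disjoint, and the vertex sets of any two distinct trees intersect exactly in `S`. -/
def IsInternallyDisjointSTrees {V : Type*} (G : SimpleGraph V) (S : Set V) {r : ℕ}
    (T : Fin r → G.Subgraph) : Prop :=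
  (∀ i, S ⊆ (T i).verts ∧ (T i).coe.IsTree) ∧
  Pairwise fun i j =>
    Disjoint (T i).edgeSet (T j).edgeSet ∧ (T i).verts ∩ (T j).verts = S

/-- The generalized `k`-connectivity `κ_k(G)`: the greatest positive integer `r` such that
for every set `S` of `k` vertices there are `r` internally disjoint `S`-trees in `G`. -/
noncomputable def genConn {V : Type*} (G : SimpleGraph V) (k : ℕ) : ℕ :=
  sSup {r : ℕ | 0 < r ∧ ∀ S : Finset V, S.card = k →
    ∃ T : Fin r → G.Subgraph, IsInternallyDisjointSTrees G (↑S) T}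

/-- `M` forms a path on 4 vertices `a - b - c - d`. -/
def IsP4Edges {V : Type*} (M : Set (Sym2 V)) : Prop :=
  ∃ a b c d : V, [a, b, c, d].Nodup ∧ M = {s(a, b), s(b, c), s(c, d)}

/-- `M` forms the vertex-disjoint union of a path on 3 vertices `a - b - c`
and a single edge `d - e`. -/
def IsP3UnionP2Edges {V : Type*} (M : Set (Sym2 V)) : Prop :=
  ∃ a b c d e : V, [a, b, c, d, e].Nodup ∧ M = {s(a, b), s(b, c), s(d, e)}

/-- `M` forms the vertex-disjoint union of a triangle on `a, b, c`
and a single edge `d - e`. -/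
def IsC3UnionP2Edges {V : Type*} (M : Set (Sym2 V)) : Prop :=
  ∃ a b c d e : V, [a, b, c, d, e].Nodup ∧ M = {s(a, b), s(b, c), s(a, c), s(d, e)}

/-- `M` is a matching: no two distinct members of `M` share a vertex. -/
def IsMatchingEdges {V : Type*} (M : Set (Sym2 V)) : Prop :=
  M.Pairwise fun e f => ∀ v : V, v ∈ e → v ∉ f


lemma IsMatchingEdges.right_unique {V : Type*} {M : Set (Sym2 V)} (hM : IsMatchingEdges M)
    {u v w : V} (hv : s(u, v) ∈ M) (hw : s(u, w) ∈ M) : v = w := by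
  by_contra h
  exact hM hv hw (mt Sym2.congr_right.1 h) u (by simp) (by simp)

/-- A connected subgraph contains a tree on the same vertex set. -/
lemma SimpleGraph.Subgraph.Connected.exists_isTree_le {V : Type*} [Finite V] {G : SimpleGraph V}
    {H : G.Subgraph} (hH : H.Connected) :
    ∃ T ≤ H, T.verts = H.verts ∧ T.coe.IsTree := by
  obtain ⟨F, hF, hT⟩ := hH.coe.exists_isTree_le
  let T : G.Subgraph :=
    { verts := H.verts
      Adj := fun u v => ∃ (hu : u ∈ H.verts) (hv : v ∈ H.verts), F.Adj ⟨u, hu⟩ ⟨v, hv⟩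
      adj_sub := fun ⟨_, _, h⟩ => H.adj_sub (hF h)
      edge_vert := fun ⟨hu, _, _⟩ => hu
      symm := ⟨fun _ _ ⟨hu, hv, h⟩ => ⟨hv, hu, h.symm⟩⟩ }
  have hTF : T.coe = F := by
    ext ⟨u, hu⟩ ⟨v, hv⟩
    exact ⟨fun ⟨_, _, h⟩ => h, fun h => ⟨hu, hv, h⟩⟩
  exact ⟨T, ⟨le_rfl, fun _ _ ⟨_, _, h⟩ => hF h⟩, rfl, hTF ▸ hT⟩

/-- The subgraph of the complete graph without `M` on the vertices of the triple `e` and `v`.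
It joins `v` to the triple and, if `M` contains the edge from `v` to `e i`, also `e i` to
`e (i + 1)`. -/
def tripleLink {V : Type*} (M : Set (Sym2 V)) (e : Fin 3 → V) (v : V) :
    ((⊤ : SimpleGraph V).deleteEdges M).Subgraph where
  verts := insert v (Set.range e)
  Adj x y := ((⊤ : SimpleGraph V).deleteEdges M).Adj x y ∧
    ∃ i, s(x, y) = s(v, e i) ∨ s(e i, v) ∈ M ∧ s(x, y) = s(e i, e (i + 1))
  adj_sub h := h.1
  edge_vert := by
    rintro x y ⟨-, i, h | ⟨-, h⟩⟩ <;> rcases Sym2.eq_iff.1 h with ⟨rfl, -⟩ | ⟨rfl, -⟩ <;> simp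
  symm := ⟨fun x y h => ⟨h.1.symm, by rw [Sym2.eq_swap]; exact h.2⟩⟩

lemma tripleLink_connected {V : Type*} {M : Set (Sym2 V)} (hM : IsMatchingEdges M)
    {e : Fin 3 → V} (he : Function.Injective e) {v : V} (hv : v ∉ Set.range e) :
    (tripleLink M e v).Connected := by
  have hne (i) : e i ≠ v := fun h => hv ⟨i, h⟩
  have hvmem : v ∈ (tripleLink M e v).verts := Set.mem_insert _ _
  have hmem (i) : e i ∈ (tripleLink M e v).verts := Set.mem_insert_of_mem _ ⟨i, rfl⟩
  have hadj (i) (hi : s(e i, v) ∉ M) :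
      (tripleLink M e v).coe.Adj ⟨v, hvmem⟩ ⟨e i, hmem i⟩ := by
    refine ⟨?_, i, Or.inl rfl⟩
    rw [deleteEdges_adj]
    exact ⟨(hne i).symm, by rwa [Sym2.eq_swap]⟩
  refine ⟨(connected_iff_exists_forall_reachable _).2 ⟨⟨v, hvmem⟩, ?_⟩⟩
  rintro ⟨w, rfl | ⟨i, rfl⟩⟩
  · rfl
  by_cases hi : s(e i, v) ∈ M
  · have hsucc : e i ≠ e (i + 1) := he.ne (by fin_cases i <;> decide)
    have hi' : s(e (i + 1), v) ∉ M := fun h => hsucc <|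
      hM.right_unique (u := v) (by rwa [Sym2.eq_swap]) (by rwa [Sym2.eq_swap])
    have hstep : (tripleLink M e v).coe.Adj ⟨e i, hmem i⟩ ⟨e (i + 1), hmem _⟩ := by
      refine ⟨?_, i, Or.inr ⟨hi, rfl⟩⟩
      rw [deleteEdges_adj]
      exact ⟨hsucc, fun h => hne _ (hM.right_unique h hi)⟩
    exact (hadj _ hi').reachable.trans hstep.symm.reachable
  · exact (hadj i hi).reachable

lemma tripleLink_disjoint_edgeSet {V : Type*} {M : Set (Sym2 V)} (hM : IsMatchingEdges M)
    {e : Fin 3 → V} (he : Function.Injective e) {v w : V} (hv : v ∉ Set.range e)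
    (hw : w ∉ Set.range e) (hvw : v ≠ w) :
    Disjoint (tripleLink M e v).edgeSet (tripleLink M e w).edgeSet := by
  have hv' (i) : e i ≠ v := fun h => hv ⟨i, h⟩
  have hw' (i) : e i ≠ w := fun h => hw ⟨i, h⟩
  rw [Set.disjoint_left]
  intro p
  induction p with | _ x y
  rintro ⟨-, i, h | ⟨hi, h⟩⟩ ⟨-, j, h' | ⟨hj, h'⟩⟩ <;> rw [h, Sym2.eq_iff] at h'
  · grind
  · grind
  · grind
  · have hij : i = j := by
      rcases h' with ⟨h, -⟩ | ⟨h, h'⟩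
      · exact he h
      · have h := he h
        have h' := he h'
        omega
    exact hvw (hM.right_unique hi (hij ▸ hj))

lemma exists_isInternallyDisjointSTrees_deleteMatching {V : Type*} [Fintype V]
    {M : Set (Sym2 V)} (hM : IsMatchingEdges M) {S : Finset V} (hS : S.card = 3) :
    ∃ T : Fin (Fintype.card V - 3) → ((⊤ : SimpleGraph V).deleteEdges M).Subgraph,
      IsInternallyDisjointSTrees _ (↑S) T := by
  classical
  let e : Fin 3 → V := fun i => (S.equivFinOfCardEq hS).symm i
  have he : Function.Injective e :=
    Subtype.val_injective.comp (S.equivFinOfCardEq hS).symm.injective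
  have hrange : Set.range e = S := by
    ext x
    refine ⟨?_, fun hx => ⟨S.equivFinOfCardEq hS ⟨x, hx⟩, by simp [e]⟩⟩
    rintro ⟨i, rfl⟩
    exact ((S.equivFinOfCardEq hS).symm i).2
  let f := (Sᶜ.equivFinOfCardEq (by rw [Finset.card_compl, hS] :
    Sᶜ.card = Fintype.card V - 3)).symm
  have hf (i) : (f i : V) ∉ Set.range e := by
    rw [hrange]
    exact Finset.mem_compl.1 (f i).2
  choose T hTle hTverts hTtree using fun i => (tripleLink_connected hM he (hf i)).exists_isTree_le
  refine ⟨T, fun i => ⟨?_, hTtree i⟩, fun i j hij => ?_⟩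
  · rw [hTverts, ← hrange]
    exact Set.subset_insert _ _
  have hne : (f i : V) ≠ f j := fun h => hij (f.injective (Subtype.ext h))
  refine ⟨(tripleLink_disjoint_edgeSet hM he (hf i) (hf j) hne).mono
    (Subgraph.edgeSet_mono (hTle i)) (Subgraph.edgeSet_mono (hTle j)), ?_⟩
  rw [hTverts, hTverts, ← hrange]
  have hi := hf i
  have hj := hf j
  ext x
  change (x = f i ∨ x ∈ Set.range e) ∧ (x = f j ∨ x ∈ Set.range e) ↔ x ∈ Set.range e
  grind

lemma sum_ite_one_le_one {ι : Type*} [Fintype ι] {p : ι → Prop} [DecidablePred p]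
    (hp : ∀ i j, p i → p j → i = j) : ∑ i, (if p i then 1 else 0) ≤ 1 := by
  rw [Finset.sum_boole, Nat.cast_id, Finset.card_le_one]
  simpa using fun i hi j hj => hp i j hi hj

lemma lt_of_isInternallyDisjointSTrees {V : Type*} [Fintype V] {G : SimpleGraph V}
    {x y z w : V} (hd : [x, y, z, w].Nodup) (hxy : ¬ G.Adj x y) (hzw : ¬ G.Adj z w) {r : ℕ}
    {T : Fin r → G.Subgraph} (hT : IsInternallyDisjointSTrees G {x, y, z} T) :
    r < Fintype.card V - 2 := by
  classical
  obtain ⟨htree, hdisj⟩ := hT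
  let O : Finset V := {x, y, z, w}ᶜ
  have hO : O.card + 4 = Fintype.card V := by
    have h4 : ({x, y, z, w} : Finset V).card = 4 := by
      simpa using List.toFinset_card_of_nodup hd
    have := Finset.card_le_univ ({x, y, z, w} : Finset V)
    rw [Finset.card_compl]
    omega
  -- Every tree has weight at least two, while the total weight is at most `2 * card V - 5`.
  have hweight (i) : 2 ≤ 2 * (∑ v ∈ O, if v ∈ (T i).verts then 1 else 0) +
      (if w ∈ (T i).verts then 1 else 0) + (if s(x, z) ∈ (T i).edgeSet then 1 else 0) +
      (if s(y, z) ∈ (T i).edgeSet then 1 else 0) := by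
    by_cases h : ∃ v ∈ O, v ∈ (T i).verts
    · obtain ⟨v, hvO, hv⟩ := h
      have := Finset.single_le_sum (f := fun v => if v ∈ (T i).verts then 1 else 0)
        (fun _ _ => Nat.zero_le _) hvO
      simp only [hv, if_true] at this
      omega
    · have hverts : ∀ v ∈ (T i).verts, v = x ∨ v = y ∨ v = z ∨ v = w := by
        intro v hv
        by_contra hn
        exact h ⟨v, by simpa [O] using hn, hv⟩
      have hsub := (htree i).1
      have hx : x ∈ (T i).verts := hsub (by simp)
      have hy : y ∈ (T i).verts := hsub (by simp)
      have hz : z ∈ (T i).verts := hsub (by simp)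
      have hnb : ∀ u ∈ (T i).verts, ∃ v, (T i).Adj u v := by
        intro u hu
        have : Nontrivial (T i).verts :=
          ⟨⟨x, hx⟩, ⟨y, hy⟩, fun h => by simp [Subtype.ext_iff] at h; simp [h] at hd⟩
        obtain ⟨v, hv⟩ := (htree i).2.connected.preconnected.exists_adj_of_nontrivial ⟨u, hu⟩
        exact ⟨v, hv⟩
      have hx' := hnb x hx
      have hy' := hnb y hy
      have hz' := hnb z hz
      have key : ∀ u v, (T i).Adj u v → G.Adj u v ∧ (T i).Adj v u ∧ v ∈ (T i).verts ∧ u ≠ v :=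
        fun u v h => ⟨(T i).adj_sub h, h.symm, h.snd_mem, h.ne⟩
      simp only [Subgraph.mem_edgeSet]
      have hyx : ¬ G.Adj y x := fun h => hxy h.symm
      grind
  have hvert (v) (hv : v ∉ ({x, y, z} : Set V)) :
      ∑ i, (if v ∈ (T i).verts then 1 else 0) ≤ 1 :=
    sum_ite_one_le_one fun i j hi hj => by
      by_contra hij
      exact hv ((hdisj hij).2 ▸ ⟨hi, hj⟩)
  have hedge (p) : ∑ i, (if p ∈ (T i).edgeSet then 1 else 0) ≤ 1 :=
    sum_ite_one_le_one fun i j hi hj => by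
      by_contra hij
      exact Set.disjoint_left.1 (hdisj hij).1 hi hj
  have hsum := Finset.sum_le_sum fun i (_ : i ∈ Finset.univ) => hweight i
  simp only [Finset.sum_add_distrib, ← Finset.mul_sum] at hsum
  rw [Finset.sum_comm] at hsum
  have hOsum : ∑ v ∈ O, ∑ i, (if v ∈ (T i).verts then 1 else 0) ≤ O.card := by
    refine (Finset.sum_le_card_nsmul _ _ 1 fun v hv => hvert v ?_).trans (by simp)
    simp only [O, Finset.mem_compl, Finset.mem_insert, Finset.mem_singleton] at hv
    simp only [Set.mem_insert_iff, Set.mem_singleton_iff]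
    tauto
  have hwsum := hvert w (by simp at hd ⊢; grind)
  have hxz := hedge s(x, z)
  have hyz := hedge s(y, z)
  simp only [Finset.sum_const, Finset.card_univ, Fintype.card_fin, smul_eq_mul] at hsum
  omega

theorem genConn_three_deleteMatching (n : ℕ) (hn : 4 ≤ n) (M : Set (Sym2 (Fin n)))
    (hM : M ⊆ (⊤ : SimpleGraph (Fin n)).edgeSet) (hmatch : IsMatchingEdges M)
    (hcard : 2 ≤ M.ncard) :
    genConn ((⊤ : SimpleGraph (Fin n)).deleteEdges M) 3 = n - 3 := by
  classical
  refine IsGreatest.csSup_eq ⟨⟨by omega, fun S hS => ?_⟩, fun r ⟨_, hr⟩ => ?_⟩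
  · have := exists_isInternallyDisjointSTrees_deleteMatching hmatch hS
    rwa [Fintype.card_fin] at this
  · obtain ⟨p, hp, q, hq, hpq⟩ := (Set.one_lt_ncard (Set.toFinite M)).1 hcard
    induction p with | _ x y
    induction q with | _ z w
    have hxy : x ≠ y := by simpa using hM hp
    have hzw : z ≠ w := by simpa using hM hq
    have hdisj := hmatch hp hq hpq
    have hx := hdisj x (by simp)
    have hy := hdisj y (by simp)
    simp only [Sym2.mem_iff, not_or] at hx hy
    have hd : [x, y, z, w].Nodup := by simp; tauto
    obtain ⟨T, hT⟩ := hr {x, y, z} (Finset.card_eq_three.2 ⟨x, y, z, hxy, hx.1, hy.1, rfl⟩)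
    rw [Finset.coe_insert, Finset.coe_insert, Finset.coe_singleton] at hT
    have := lt_of_isInternallyDisjointSTrees hd (by simp [hp]) (by simp [hq]) hT
    rw [Fintype.card_fin] at this
    omega
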